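/- Let g ≥ 2 and 1 ≤ ℓ ≤ g be integers, set n = 2g+2, and let r_ℓ be the recursively defined rank function. (a) If ℓ ≤ i ≤ g−2 and i ≡ ℓ (mod 2), then r_ℓ(i,ℓ)·r_ℓ(n−i−2,ℓ) ≤ r_ℓ(i+2,ℓ)·r_ℓ(n−i−4,ℓ). (b) If 1 ≤ i ≤ g and i ≡ ℓ+1 (mod 2), then r_ℓ(i,ℓ)·r_ℓ(n−i−2,ℓ) = 0. -/

import Mathlib

/-- The recursively defined rank function `r ℓ j t`, computing the rank of the
vector bundle of conformal blocks `V(sl₂, ℓ, (ω₁,…,ω₁ (j times), t·ω₁))`: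
`r ℓ 0 0 = 1`, `r ℓ 0 t = 0` for `t > 0`, and for `j ≥ 1`,
`r ℓ j t = 0` if `t > ℓ`, while `r ℓ j t = r ℓ (j-1) (t-1) + r ℓ (j-1) (t+1)`
for `0 ≤ t ≤ ℓ` (with the convention `r ℓ (j-1) (-1) = 0`). -/
def cbRank (ℓ : ℕ) : ℕ → ℕ → ℕ
  | 0, t => if t = 0 then 1 else 0
  | j + 1, t =>
      if ℓ < t then 0
      else (if t = 0 then 0 else cbRank ℓ j (t - 1)) + cbRank ℓ j (t + 1)

theorem cbRank_succ_zero (ℓ j : ℕ) : cbRank ℓ (j + 1) 0 = cbRank ℓ j 1 := by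
  simp [cbRank]

theorem cbRank_succ_succ {ℓ t : ℕ} (j : ℕ) (ht : t + 1 ≤ ℓ) :
    cbRank ℓ (j + 1) (t + 1) = cbRank ℓ j t + cbRank ℓ j (t + 2) := by
  simp [cbRank, not_lt.mpr ht]

theorem cbRank_eq_zero_of_lt {ℓ t : ℕ} (j : ℕ) (ht : ℓ < t) : cbRank ℓ j t = 0 := by
  cases j with
  | zero => simp [cbRank]; omega
  | succ j => simp [cbRank, ht]

theorem cbRank_eq_zero_of_odd (ℓ : ℕ) {j t : ℕ} (h : (j + t) % 2 = 1) : cbRank ℓ j t = 0 := by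
  induction j generalizing t with
  | zero => simp [cbRank]; omega
  | succ j ih =>
    rcases lt_or_ge ℓ t with ht | ht
    · exact cbRank_eq_zero_of_lt _ ht
    · cases t with
      | zero => rw [cbRank_succ_zero, ih (by omega)]
      | succ t => rw [cbRank_succ_succ j ht, ih (by omega), ih (by omega)]

/-- Total positivity of order two: the `2 × 2` minors of `cbRank ℓ` whose columns have the same
parity are nonnegative. -/
theorem cbRank_mul_le_mul (ℓ d : ℕ) (j s k : ℕ) :
    cbRank ℓ j (s + 2 * k) * cbRank ℓ (j + d) s ≤
      cbRank ℓ j s * cbRank ℓ (j + d) (s + 2 * k) := by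
  induction j generalizing s k with
  | zero =>
    rcases Nat.eq_zero_or_pos k with rfl | hk
    · simp
    · have : cbRank ℓ 0 (s + 2 * k) = 0 := by simp [cbRank]; omega
      simp [this]
  | succ j ih =>
    rcases k with _ | k
    · simp
    rcases lt_or_ge ℓ (s + 2 * (k + 1)) with ht | ht
    · simp [cbRank_eq_zero_of_lt _ ht]
    have e : s + 2 * (k + 1) = (s + 1 + 2 * k) + 1 := by ring
    rw [add_right_comm j 1 d, e, cbRank_succ_succ _ (e ▸ ht), cbRank_succ_succ _ (e ▸ ht)]
    have h₁ := ih (s + 1) k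
    have h₂ := ih (s + 1) (k + 1)
    rw [show s + 1 + 2 * (k + 1) = s + 1 + 2 * k + 2 by ring] at h₂
    cases s with
    | zero =>
      rw [cbRank_succ_zero, cbRank_succ_zero]
      linarith
    | succ s =>
      rw [cbRank_succ_succ _ (by omega), cbRank_succ_succ _ (by omega)]
      have h₃ := ih s (k + 1)
      have h₄ := ih s (k + 2)
      rw [show s + 2 * (k + 1) = s + 1 + 1 + 2 * k by ring] at h₃
      rw [show s + 2 * (k + 2) = s + 1 + 1 + 2 * k + 2 by ring] at h₄
      linarith

theorem cbRank_add_two_one (j : ℕ) : cbRank 1 (j + 2) 1 = cbRank 1 j 1 := by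
  rw [cbRank_succ_succ _ le_rfl, cbRank_succ_zero,
    cbRank_eq_zero_of_lt (t := 0 + 2) _ (by omega), add_zero]

theorem cbRank_add_two_top (ℓ j : ℕ) :
    cbRank (ℓ + 2) (j + 2) (ℓ + 2) = cbRank (ℓ + 2) j ℓ + cbRank (ℓ + 2) j (ℓ + 2) := by
  rw [cbRank_succ_succ _ le_rfl, cbRank_succ_succ _ (by omega),
    cbRank_eq_zero_of_lt (j + 1) (by omega), add_zero]

/-- Log-concavity, in steps of two, of `j ↦ cbRank ℓ j ℓ`. -/
theorem cbRank_top_mul_le_mul {ℓ : ℕ} (hℓ : 1 ≤ ℓ) (j d : ℕ) :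
    cbRank ℓ j ℓ * cbRank ℓ (j + d + 2) ℓ ≤ cbRank ℓ (j + 2) ℓ * cbRank ℓ (j + d) ℓ := by
  obtain rfl | ⟨m, rfl⟩ : ℓ = 1 ∨ ∃ m, ℓ = m + 2 := by
    rcases hℓ.eq_or_lt with h | h
    · exact .inl h.symm
    · exact .inr ⟨ℓ - 2, by omega⟩
  · rw [cbRank_add_two_one, cbRank_add_two_one]
  · rw [cbRank_add_two_top, cbRank_add_two_top]
    have h := cbRank_mul_le_mul (m + 2) d j m 1
    rw [mul_one] at h
    linarith

theorem cbRank_intersection_numbers_nondecreasing (g ℓ : ℕ) (hg : 2 ≤ g)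
    (hℓ1 : 1 ≤ ℓ) (hℓg : ℓ ≤ g) :
    (∀ i : ℕ, ℓ ≤ i → i ≤ g - 2 → i % 2 = ℓ % 2 →
      cbRank ℓ i ℓ * cbRank ℓ (2 * g + 2 - i - 2) ℓ ≤
        cbRank ℓ (i + 2) ℓ * cbRank ℓ (2 * g + 2 - i - 4) ℓ) ∧
    (∀ i : ℕ, 1 ≤ i → i ≤ g → i % 2 = (ℓ + 1) % 2 →
      cbRank ℓ i ℓ * cbRank ℓ (2 * g + 2 - i - 2) ℓ = 0) := by
  refine ⟨fun i _ hi _ => ?_, fun i _ _ hi => ?_⟩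
  · have h := cbRank_top_mul_le_mul hℓ1 i (2 * g - 2 * i - 2)
    rwa [show i + (2 * g - 2 * i - 2) + 2 = 2 * g + 2 - i - 2 by omega,
      show i + (2 * g - 2 * i - 2) = 2 * g + 2 - i - 4 by omega] at h
  · rw [cbRank_eq_zero_of_odd ℓ (by omega), zero_mul]
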